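/- Fix integers n ≥ 1 and k₁, k₂ ≥ 0 and a real C > 1. Then there exist constants K > 0 and δ₀ > 0 such that for all (x, t) ∈ ℝ^{2n} × ℝ with x ≠ 0, t ≠ 0, δ ≤ δ₀ and 1/C ≤ κ ≤ C, one has |p_{1,k₁,k₂}(x,t) − P(x,t)| ≤ K δ |P(x,t)|, where P(x,t) = ((−1)^{k₂} π^{k₁+k₂} / (4ⁿ (πδ)^{n+k₁−1})) · e^{−d(x,t)²/4} · e^{−κ} · I_{n+k₁−1}(κ). -/

import Mathlib

open Real Complex MeasureTheory

/-- θ(y) = (2y − sin(2y))/(2 sin²(y)) for y ≠ 0, θ(0) = 0. -/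
noncomputable def theta (y : ℝ) : ℝ :=
  if y = 0 then 0 else (2 * y - Real.sin (2 * y)) / (2 * Real.sin y ^ 2)

/-- The radial derivative p_{1,k₁,k₂} of the heat kernel at time 1 on the Heisenberg
group ℍⁿ, with R = |x|²/4 (integrand extended by continuity at λ = 0). -/
noncomputable def pH (n k₁ k₂ : ℕ) (x : EuclideanSpace ℝ (Fin (2 * n))) (t : ℝ) : ℂ :=
  (2 * (-1 : ℂ) ^ k₁ * Complex.I ^ k₂ / (4 * (π : ℂ)) ^ (n + 1)) *
    ∫ lam : ℝ,
      if lam = 0 then (if k₂ = 0 then Complex.exp (-((‖x‖ ^ 2 / 4 : ℝ) : ℂ)) else 0)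
      else
        Complex.exp (Complex.I * (lam : ℂ) * (|t| : ℝ)
            - ((‖x‖ ^ 2 / 4 * lam * Real.cosh lam / Real.sinh lam : ℝ) : ℂ)) *
          ((lam : ℂ) ^ (n + k₁ + k₂) * ((Real.cosh lam : ℝ) : ℂ) ^ k₁
            / ((Real.sinh lam : ℝ) : ℂ) ^ (n + k₁))

/-- Modified Bessel function I_ν, ν ∈ ℤ; terms with Γ at a nonpositive integer vanish. -/
noncomputable def besselI (ν : ℤ) (s : ℝ) : ℝ :=
  ∑' k : ℕ, s ^ (2 * (k : ℤ) + ν) /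
    ((2 : ℝ) ^ (2 * (k : ℤ) + ν) * (Nat.factorial k) * Real.Gamma ((k : ℝ) + (ν : ℝ) + 1))

/-- The integral of `g` along the positively oriented boundary of the square `[-1, 1] × [-1, 1]`. -/
noncomputable def squareIntegral (g : ℂ → ℂ) : ℂ :=
  ∫ t in (-1 : ℝ)..1, (g (t - I) - g (t + I) + I * g (1 + t * I) - I * g (-1 + t * I))

/-- The boundary of the square `[-1, 1] × [-1, 1]` in `ℂ`. -/
def squareBoundary : Set ℂ := {z | max |z.re| |z.im| = 1}

lemma one_le_norm_of_mem_squareBoundary {z : ℂ} (hz : z ∈ squareBoundary) : 1 ≤ ‖z‖ := by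
  have hz' : max |z.re| |z.im| = 1 := hz
  rw [← hz']
  exact max_le (Complex.abs_re_le_norm z) (Complex.abs_im_le_norm z)

lemma norm_le_two_of_mem_squareBoundary {z : ℂ} (hz : z ∈ squareBoundary) : ‖z‖ ≤ 2 := by
  have hz' : max |z.re| |z.im| = 1 := hz
  have h1 := le_max_left |z.re| |z.im|
  have h2 := le_max_right |z.re| |z.im|
  have := Complex.norm_le_abs_re_add_abs_im z
  linarith

lemma squareBoundary_sides {t : ℝ} (ht : t ∈ Set.uIcc (-1 : ℝ) 1) :
    (t - I : ℂ) ∈ squareBoundary ∧ (t + I : ℂ) ∈ squareBoundary ∧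
      (1 + t * I : ℂ) ∈ squareBoundary ∧ (-1 + t * I : ℂ) ∈ squareBoundary := by
  rw [Set.uIcc_of_le (by norm_num), Set.mem_Icc] at ht
  have := abs_le.2 ht
  simp [squareBoundary, this]

lemma continuousOn_squareIntegrand {g : ℂ → ℂ} (hg : ContinuousOn g squareBoundary) :
    ContinuousOn (fun t : ℝ ↦ g (t - I) - g (t + I) + I * g (1 + t * I) - I * g (-1 + t * I))
      (Set.uIcc (-1) 1) := by
  have h (φ : ℝ → ℂ) (hφ : Continuous φ) (hm : ∀ t ∈ Set.uIcc (-1 : ℝ) 1, φ t ∈ squareBoundary) :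
      ContinuousOn (fun t ↦ g (φ t)) (Set.uIcc (-1) 1) :=
    hg.comp hφ.continuousOn hm
  have h1 := h (fun t ↦ t - I) (by fun_prop) fun t ht ↦ (squareBoundary_sides ht).1
  have h2 := h (fun t ↦ t + I) (by fun_prop) fun t ht ↦ (squareBoundary_sides ht).2.1
  have h3 := h (fun t ↦ 1 + t * I) (by fun_prop) fun t ht ↦ (squareBoundary_sides ht).2.2.1
  have h4 := h (fun t ↦ -1 + t * I) (by fun_prop) fun t ht ↦ (squareBoundary_sides ht).2.2.2
  exact ((h1.sub h2).add (h3.const_mul _)).sub (h4.const_mul _)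

lemma norm_squareIntegrand_le {g : ℂ → ℂ} {B : ℝ} (hB : ∀ z ∈ squareBoundary, ‖g z‖ ≤ B)
    {t : ℝ} (ht : t ∈ Set.uIcc (-1 : ℝ) 1) :
    ‖g (t - I) - g (t + I) + I * g (1 + t * I) - I * g (-1 + t * I)‖ ≤ 4 * B := by
  obtain ⟨h1, h2, h3, h4⟩ := squareBoundary_sides ht
  refine (norm_sub_le _ _).trans ?_
  have e1 := norm_add_le (g (t - I) - g (t + I)) (I * g (1 + t * I))
  have e2 := norm_sub_le (g (t - I)) (g (t + I))
  have e3 : ‖I * g (1 + t * I)‖ = ‖g (1 + t * I)‖ := by simp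
  have e4 : ‖I * g (-1 + t * I)‖ = ‖g (-1 + t * I)‖ := by simp
  linarith [hB _ h1, hB _ h2, hB _ h3, hB _ h4]

lemma norm_squareIntegral_le {g : ℂ → ℂ} {B : ℝ} (hB : ∀ z ∈ squareBoundary, ‖g z‖ ≤ B) :
    ‖squareIntegral g‖ ≤ 8 * B := by
  refine (intervalIntegral.norm_integral_le_of_norm_le_const fun t ht ↦
    norm_squareIntegrand_le hB (Set.uIoc_subset_uIcc ht)).trans ?_
  norm_num
  linarith

lemma squareIntegral_sub {f g : ℂ → ℂ} (hf : ContinuousOn f squareBoundary)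
    (hg : ContinuousOn g squareBoundary) :
    squareIntegral (fun z ↦ f z - g z) = squareIntegral f - squareIntegral g := by
  unfold squareIntegral
  rw [← intervalIntegral.integral_sub (continuousOn_squareIntegrand hf).intervalIntegrable
    (continuousOn_squareIntegrand hg).intervalIntegrable]
  congr 1
  ext t
  ring

lemma squareIntegral_const_mul (c : ℂ) (g : ℂ → ℂ) :
    squareIntegral (fun z ↦ c * g z) = c * squareIntegral g := by
  unfold squareIntegral
  rw [← intervalIntegral.integral_const_mul]
  congr 1
  ext t
  ring

lemma squareIntegral_congr {f g : ℂ → ℂ} (h : ∀ z ∈ squareBoundary, f z = g z) :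
    squareIntegral f = squareIntegral g := by
  unfold squareIntegral
  refine intervalIntegral.integral_congr fun t ht ↦ ?_
  obtain ⟨h1, h2, h3, h4⟩ := squareBoundary_sides ht
  simp only [h _ h1, h _ h2, h _ h3, h _ h4]

lemma hasSum_squareIntegral {ι : Type*} [Countable ι] {f : ι → ℂ → ℂ} {g : ℂ → ℂ} {b : ι → ℝ}
    (hf : ∀ i, ContinuousOn (f i) squareBoundary)
    (hb : ∀ i, ∀ z ∈ squareBoundary, ‖f i z‖ ≤ b i) (hs : Summable b)
    (hg : ∀ z ∈ squareBoundary, HasSum (fun i ↦ f i z) (g z)) :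
    HasSum (fun i ↦ squareIntegral (f i)) (squareIntegral g) := by
  refine intervalIntegral.hasSum_integral_of_dominated_convergence (fun i _ ↦ 4 * b i)
    ?_ ?_ ?_ ?_ ?_
  · intro i
    exact ((continuousOn_squareIntegrand (hf i)).mono Set.uIoc_subset_uIcc).aestronglyMeasurable
      measurableSet_uIoc
  · exact fun i ↦ .of_forall fun t ht ↦ norm_squareIntegrand_le (hb i) (Set.uIoc_subset_uIcc ht)
  · exact .of_forall fun t _ ↦ hs.mul_left 4
  · exact intervalIntegrable_const
  · refine .of_forall fun t ht ↦ ?_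
    obtain ⟨h1, h2, h3, h4⟩ := squareBoundary_sides (Set.uIoc_subset_uIcc ht)
    exact (((hg _ h1).sub (hg _ h2)).add ((hg _ h3).mul_left _)).sub ((hg _ h4).mul_left _)

lemma zero_notMem_squareBoundary : (0 : ℂ) ∉ squareBoundary := by
  simp [squareBoundary]

lemma continuousOn_zpow_squareBoundary (q : ℤ) :
    ContinuousOn (fun z : ℂ ↦ z ^ q) squareBoundary := fun z hz ↦
  (continuousAt_zpow₀ z q (.inl fun h ↦ zero_notMem_squareBoundary (h ▸ hz))).continuousWithinAt

lemma squareIntegral_zpow_of_ne {q : ℤ} (hq : q ≠ -1) :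
    squareIntegral (fun z ↦ z ^ q) = 0 := by
  have hq' : ((q + 1 : ℤ) : ℂ) ≠ 0 := by
    norm_cast
    omega
  set P : ℂ → ℂ := fun z ↦ z ^ (q + 1) / ((q + 1 : ℤ) : ℂ)
  have hP {z : ℂ} (hz : z ∈ squareBoundary) : HasDerivAt P (z ^ q) z := by
    have := (hasDerivAt_zpow (q + 1) z (.inl fun h ↦ zero_notMem_squareBoundary (h ▸ hz))).div_const
      ((q + 1 : ℤ) : ℂ)
    rwa [mul_div_cancel_left₀ _ hq', add_sub_cancel_right] at this
  have hd (c e : ℂ) (t : ℝ) (hz : c + e * t ∈ squareBoundary) :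
      HasDerivAt (fun s : ℝ ↦ P (c + e * s)) (e * (c + e * t) ^ q) t := by
    have h1 : HasDerivAt (fun s : ℝ ↦ c + e * s) e t := by
      simpa using ((ofRealCLM.hasDerivAt (x := t)).const_mul e).const_add c
    have := HasDerivAt.comp t (hP hz) h1
    rwa [mul_comm] at this
  unfold squareIntegral
  rw [intervalIntegral.integral_eq_sub_of_hasDerivAt
    (f := fun s : ℝ ↦ P (-I + 1 * s) - P (I + 1 * s) + P (1 + I * s) - P (-1 + I * s))]
  · simp only [ofReal_one, ofReal_neg, mul_one, mul_neg]
    rw [show (-I + -1 : ℂ) = -1 + -I by ring, show (I + -1 : ℂ) = -1 + I by ring,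
      show (-I + 1 : ℂ) = 1 + -I by ring, show (I + 1 : ℂ) = 1 + I by ring]
    ring
  · intro t ht
    obtain ⟨h1, h2, h3, h4⟩ := squareBoundary_sides ht
    have e1 : -I + 1 * (t : ℂ) = t - I := by ring
    have e2 : I + 1 * (t : ℂ) = t + I := by ring
    have e3 : 1 + I * (t : ℂ) = 1 + t * I := by ring
    have e4 : -1 + I * (t : ℂ) = -1 + t * I := by ring
    have k1 := hd (-I) 1 t (e1 ▸ h1)
    have k2 := hd I 1 t (e2 ▸ h2)
    have k3 := hd 1 I t (e3 ▸ h3)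
    have k4 := hd (-1) I t (e4 ▸ h4)
    have := ((k1.sub k2).add k3).sub k4
    rw [e1, e2, e3, e4, one_mul, one_mul] at this
    exact this
  · exact (continuousOn_squareIntegrand (continuousOn_zpow_squareBoundary q)).intervalIntegrable

lemma squareIntegral_inv : squareIntegral (fun z ↦ z ^ (-1 : ℤ)) = 2 * π * I := by
  unfold squareIntegral
  have h (t : ℝ) : ((t - I : ℂ) ^ (-1 : ℤ) - (t + I) ^ (-1 : ℤ) + I * (1 + t * I) ^ (-1 : ℤ)
      - I * (-1 + t * I) ^ (-1 : ℤ)) = 4 * I * (((1 + t ^ 2)⁻¹ : ℝ) : ℂ) := by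
    have h0 : (1 + t ^ 2 : ℂ) ≠ 0 := by
      norm_cast
      positivity
    have h1 : (t - I : ℂ) ≠ 0 := fun h ↦ h0 (by linear_combination (t + I : ℂ) * h + Complex.I_sq)
    have h2 : (t + I : ℂ) ≠ 0 := fun h ↦ h0 (by linear_combination (t - I : ℂ) * h + Complex.I_sq)
    have h3 : (1 + t * I : ℂ) ≠ 0 := fun h ↦
      h0 (by linear_combination (1 - t * I : ℂ) * h + t ^ 2 * Complex.I_sq)
    have h4 : (-1 + t * I : ℂ) ≠ 0 := fun h ↦
      h0 (by linear_combination (-1 - t * I : ℂ) * h + t ^ 2 * Complex.I_sq)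
    simp only [zpow_neg_one]
    have a1 : (t - I : ℂ)⁻¹ = (t + I) * (1 + t ^ 2 : ℂ)⁻¹ := by
      field_simp
      linear_combination Complex.I_sq
    have a2 : (t + I : ℂ)⁻¹ = (t - I) * (1 + t ^ 2 : ℂ)⁻¹ := by
      field_simp
      linear_combination Complex.I_sq
    have a3 : (1 + t * I : ℂ)⁻¹ = (1 - t * I) * (1 + t ^ 2 : ℂ)⁻¹ := by
      field_simp
      linear_combination t ^ 2 * Complex.I_sq
    have a4 : (-1 + t * I : ℂ)⁻¹ = (-1 - t * I) * (1 + t ^ 2 : ℂ)⁻¹ := by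
      field_simp
      linear_combination t ^ 2 * Complex.I_sq
    rw [a1, a2, a3, a4]
    push_cast
    ring
  simp only [h]
  rw [intervalIntegral.integral_const_mul, intervalIntegral.integral_ofReal,
    integral_inv_one_add_sq, Real.arctan_one, Real.arctan_neg, Real.arctan_one]
  push_cast
  ring

/-- Shifting the line of integration across an isolated singularity at `h * I`: the difference is
the integral over the boundary of a square around the singularity. -/
lemma integral_sub_integral_shift_eq_squareIntegral {f : ℂ → ℂ} {h H r K : ℝ} (hr : 0 < r)
    (hrh : r < h) (hrH : h + r < H)
    (hd : ∀ z : ℂ, 0 ≤ z.im → z.im ≤ H → z ≠ h * I → DifferentiableAt ℂ f z)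
    (hK : ∀ s y : ℝ, 1 ≤ |s| → 0 ≤ y → y ≤ H → ‖f (s + y * I)‖ ≤ K * (1 + s ^ 2)⁻¹) :
    (∫ s : ℝ, f s) - ∫ s : ℝ, f (s + H * I) = r * squareIntegral (fun z ↦ f (h * I + r * z)) := by
  have hH : 0 < H := by linarith
  have hd' (z : ℂ) (h1 : 0 ≤ z.im) (h2 : z.im ≤ H) (h3 : z.re ≠ 0 ∨ z.im ≠ h) :
      DifferentiableAt ℂ f z := by
    refine hd z h1 h2 fun h4 ↦ ?_
    subst h4
    simp at h3
  have hcont (y : ℝ) (h1 : 0 ≤ y) (h2 : y ≤ H) (h3 : y ≠ h) :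
      Continuous fun s : ℝ ↦ f (s + y * I) := by
    refine continuous_iff_continuousAt.2 fun s ↦ ?_
    refine ContinuousAt.comp (f := fun s : ℝ ↦ (s + y * I : ℂ)) (g := f) ?_ (by fun_prop)
    exact (hd' _ (by simpa) (by simpa) (by simp [h3])).continuousAt
  have hcontv (s : ℝ) (hs : s ≠ 0) :
      ContinuousOn (fun y : ℝ ↦ f (s + y * I)) (Set.Icc 0 H) := by
    intro y hy
    refine ContinuousAt.continuousWithinAt ?_
    refine ContinuousAt.comp (f := fun y : ℝ ↦ (s + y * I : ℂ)) (g := f) ?_ (by fun_prop)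
    exact (hd' _ (by simpa using hy.1) (by simpa using hy.2) (by simp [hs])).continuousAt
  have h_line (y : ℝ) (h1 : 0 ≤ y) (h2 : y ≤ H) (h3 : y ≠ h) :
      Integrable fun s : ℝ ↦ f (s + y * I) := by
    obtain ⟨B, hB⟩ := (isCompact_Icc (a := (-1 : ℝ)) (b := 1)).exists_bound_of_continuousOn
      (hcont y h1 h2 h3).continuousOn
    have hB0 : 0 ≤ B := (norm_nonneg _).trans (hB 0 (by simp))
    have hK0 : 0 ≤ K * (1 + 1 ^ 2)⁻¹ := (norm_nonneg _).trans (hK 1 y (by simp) h1 h2)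
    have hK0' : 0 ≤ K := by
      norm_num at hK0
      exact hK0
    refine (integrable_inv_one_add_sq.const_mul (K + 2 * B)).mono'
      (hcont y h1 h2 h3).aestronglyMeasurable (.of_forall fun s ↦ ?_)
    rcases le_total 1 |s| with hs | hs
    · refine (hK s y hs h1 h2).trans ?_
      gcongr
      linarith
    · refine (hB s (abs_le.1 hs)).trans ?_
      rw [← div_eq_mul_inv, le_div_iff₀ (by positivity)]
      have : s ^ 2 ≤ 1 := (sq_le_one_iff_abs_le_one s).2 hs
      nlinarith
  have rect (a b y₁ y₂ : ℝ) (hab : a ≤ b) (h1 : 0 ≤ y₁) (h12 : y₁ ≤ y₂) (h2 : y₂ ≤ H)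
      (hav : 0 < a ∨ b < 0 ∨ h < y₁ ∨ y₂ < h) :
      (∫ x in a..b, f (x + y₁ * I)) - (∫ x in a..b, f (x + y₂ * I))
        + I * (∫ y in y₁..y₂, f (b + y * I)) - I * (∫ y in y₁..y₂, f (a + y * I)) = 0 := by
    have := Complex.integral_boundary_rect_eq_zero_of_differentiableOn f (a + y₁ * I) (b + y₂ * I)
      (fun z hz ↦ ?_)
    · simpa using this
    · rw [mem_reProdIm] at hz
      simp only [add_re, ofReal_re, mul_re, I_re, mul_zero, ofReal_im, I_im, mul_one, sub_self,
        add_zero, add_im, mul_im, zero_add, Set.uIcc_of_le hab, Set.uIcc_of_le h12,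
        Set.mem_Icc] at hz
      refine (hd' z (by linarith) (by linarith) ?_).differentiableWithinAt
      rcases hav with h | h | h | h
      · exact .inl (by linarith)
      · exact .inl (by linarith)
      · exact .inr (by linarith)
      · exact .inr (by linarith)
  have key (T : ℝ) (hT : r < T) :
      (∫ x in -T..T, f (x + (0 : ℝ) * I)) - (∫ x in -T..T, f (x + H * I))
        + I * (∫ y in (0 : ℝ)..H, f (T + y * I)) - I * (∫ y in (0 : ℝ)..H, f ((-T : ℝ) + y * I))
      = r * squareIntegral (fun z ↦ f (h * I + r * z)) := by
    have r1 := rect (-T) (-r) 0 H (by linarith) le_rfl hH.le le_rfl (.inr (.inl (by linarith)))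
    have r2 := rect r T 0 H (by linarith) le_rfl hH.le le_rfl (.inl hr)
    have r3 := rect (-r) r 0 (h - r) (by linarith) le_rfl (by linarith) (by linarith)
      (.inr (.inr (.inr (by linarith))))
    have r4 := rect (-r) r (h + r) H (by linarith) (by linarith) (by linarith) le_rfl
      (.inr (.inr (.inl (by linarith))))
    have hsplit (y : ℝ) (h1 : 0 ≤ y) (h2 : y ≤ H) (h3 : y ≠ h) :
        (∫ x in -T..T, f (x + y * I)) = (∫ x in -T..-r, f (x + y * I))
          + (∫ x in -r..r, f (x + y * I)) + ∫ x in r..T, f (x + y * I) := by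
      have hc := hcont y h1 h2 h3
      rw [intervalIntegral.integral_add_adjacent_intervals (hc.intervalIntegrable _ _)
        (hc.intervalIntegrable _ _), intervalIntegral.integral_add_adjacent_intervals
        (hc.intervalIntegrable _ _) (hc.intervalIntegrable _ _)]
    have vsplit (s : ℝ) (hs : s ≠ 0) :
        (∫ y in (0 : ℝ)..H, f (s + y * I)) = (∫ y in (0 : ℝ)..(h - r), f (s + y * I))
          + (∫ y in (h - r)..(h + r), f (s + y * I)) + ∫ y in (h + r)..H, f (s + y * I) := by
      have hc (a b : ℝ) (ha : 0 ≤ a) (hab : a ≤ b) (hb : b ≤ H) :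
          IntervalIntegrable (fun y : ℝ ↦ f (s + y * I)) volume a b := by
        refine ((hcontv s hs).mono ?_).intervalIntegrable
        rw [Set.uIcc_of_le hab]
        exact Set.Icc_subset_Icc ha hb
      rw [intervalIntegral.integral_add_adjacent_intervals
        (hc _ _ le_rfl (by linarith) (by linarith)) (hc _ _ (by linarith) (by linarith)
        (by linarith)), intervalIntegral.integral_add_adjacent_intervals
        (hc _ _ le_rfl (by linarith) (by linarith)) (hc _ _ (by linarith) (by linarith) le_rfl)]
    have hsq : r * squareIntegral (fun z ↦ f (h * I + r * z)) =
        (∫ x in -r..r, f (x + (h - r : ℝ) * I)) - (∫ x in -r..r, f (x + (h + r : ℝ) * I))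
        + I * (∫ y in (h - r)..(h + r), f (r + y * I))
        - I * (∫ y in (h - r)..(h + r), f ((-r : ℝ) + y * I)) := by
      have hs (g : ℝ → ℂ) (a : ℝ) :
          (∫ x in (a - r)..(a + r), g x) = r * ∫ t in (-1 : ℝ)..1, g (r * t + a) := by
        rw [intervalIntegral.integral_comp_mul_add _ hr.ne', Complex.real_smul, ← mul_assoc,
          ← ofReal_mul, mul_inv_cancel₀ hr.ne']
        norm_num
        congr 1 <;> ring
      have e1 := hs (fun x ↦ f (x + (h - r : ℝ) * I)) 0
      have e2 := hs (fun x ↦ f (x + (h + r : ℝ) * I)) 0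
      rw [zero_sub, zero_add] at e1 e2
      rw [e1, e2, hs, hs]
      have c1 (y : ℝ) (h1 : 0 ≤ y) (h2 : y ≤ H) (h3 : y ≠ h) :
          IntervalIntegrable (fun t : ℝ ↦ f ((r * t + 0 : ℝ) + y * I)) volume (-1) 1 :=
        ((hcont y h1 h2 h3).comp (by fun_prop : Continuous fun t : ℝ ↦ r * t + 0)
          ).intervalIntegrable _ _
      have c2 (s : ℝ) (h3 : s ≠ 0) :
          IntervalIntegrable (fun t : ℝ ↦ f (s + (r * t + h : ℝ) * I)) volume (-1) 1 := by
        refine ContinuousOn.intervalIntegrable ?_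
        refine (hcontv s h3).comp (f := fun t : ℝ ↦ r * t + h) (by fun_prop) fun t ht ↦ ?_
        rw [Set.uIcc_of_le (by norm_num), Set.mem_Icc] at ht
        constructor <;> nlinarith
      have d1 := c1 (h - r) (by linarith) (by linarith) (by linarith)
      have d2 := c1 (h + r) (by linarith) (by linarith) (by linarith)
      have d3 := c2 r hr.ne'
      have d4 := c2 (-r) (by linarith)
      have expand : squareIntegral (fun z ↦ f (h * I + r * z)) =
          (∫ t in (-1 : ℝ)..1, f ((r * t + 0 : ℝ) + (h - r : ℝ) * I))
          - (∫ t in (-1 : ℝ)..1, f ((r * t + 0 : ℝ) + (h + r : ℝ) * I))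
          + I * (∫ t in (-1 : ℝ)..1, f (r + (r * t + h : ℝ) * I))
          - I * (∫ t in (-1 : ℝ)..1, f ((-r : ℝ) + (r * t + h : ℝ) * I)) := by
        rw [← intervalIntegral.integral_const_mul, ← intervalIntegral.integral_const_mul,
          ← intervalIntegral.integral_sub d1 d2, ← intervalIntegral.integral_add (d1.sub d2)
          (d3.const_mul I), ← intervalIntegral.integral_sub ((d1.sub d2).add
          (d3.const_mul I)) (d4.const_mul I)]
        unfold squareIntegral
        congr 1
        ext t
        push_cast
        congr 1
        · congr 1
          · congr 2 <;> ring
          · congr 2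
            ring
        · congr 2
          ring
      rw [expand]
      ring
    have s1 := hsplit 0 le_rfl hH.le (by linarith)
    have s2 := hsplit H hH.le le_rfl (by linarith)
    have v1 := vsplit r hr.ne'
    have v2 := vsplit (-r) (by linarith)
    rw [hsq, s1, s2]
    linear_combination r1 + r2 + r3 + r4 + I * v1 - I * v2
  have lim1 := intervalIntegral_tendsto_integral (h_line 0 le_rfl hH.le (by linarith))
    Filter.tendsto_neg_atTop_atBot Filter.tendsto_id
  have lim2 := intervalIntegral_tendsto_integral (h_line H hH.le le_rfl (by linarith))
    Filter.tendsto_neg_atTop_atBot Filter.tendsto_id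
  have vlim (σ : ℝ) (hσ : |σ| = 1) : Filter.Tendsto
      (fun T : ℝ ↦ ∫ y in (0 : ℝ)..H, f ((σ * T : ℝ) + y * I)) Filter.atTop (nhds 0) := by
    have hT : Filter.Tendsto (fun T : ℝ ↦ K * (1 + T ^ 2)⁻¹ * H) Filter.atTop (nhds 0) := by
      have : Filter.Tendsto (fun T : ℝ ↦ (1 + T ^ 2)⁻¹) Filter.atTop (nhds 0) :=
        Filter.Tendsto.inv_tendsto_atTop
          (Filter.tendsto_atTop_add_const_left _ _ (Filter.tendsto_pow_atTop two_ne_zero))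
      simpa using (this.const_mul K).mul_const H
    refine squeeze_zero_norm' ?_ hT
    filter_upwards [Filter.eventually_ge_atTop 1] with T hT
    have habs : |σ * T| = T := by rw [abs_mul, hσ, one_mul, abs_of_nonneg (by linarith)]
    have hsq : (σ * T) ^ 2 = T ^ 2 := by rw [← sq_abs, habs]
    have := intervalIntegral.norm_integral_le_of_norm_le_const (a := 0) (b := H)
      (f := fun y : ℝ ↦ f ((σ * T : ℝ) + y * I)) (C := K * (1 + T ^ 2)⁻¹) fun y hy ↦ by
        rw [Set.uIoc_of_le hH.le] at hy
        have := hK (σ * T) y (by rwa [habs]) hy.1.le hy.2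
        rwa [hsq] at this
    rwa [sub_zero, abs_of_pos hH] at this
  have v1 := vlim 1 (by simp)
  have v2 := vlim (-1) (by simp)
  have lim := ((lim1.sub lim2).add (v1.const_mul I)).sub (v2.const_mul I)
  have lim' := lim.congr' (f₂ := fun _ ↦ r * squareIntegral (fun z ↦ f (h * I + r * z))) (by
    filter_upwards [Filter.eventually_gt_atTop r] with T hT
    simpa using key T hT)
  have := tendsto_nhds_unique lim' tendsto_const_nhds
  simpa using this

lemma hasSum_besselI (q : ℕ) (s : ℝ) :
    HasSum (fun k : ℕ ↦ (s / 2) ^ (2 * k + q) / (k.factorial * (k + q).factorial))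
      (besselI q s) := by
  have hterm (k : ℕ) : s ^ (2 * (k : ℤ) + q) / ((2 : ℝ) ^ (2 * (k : ℤ) + q) * (Nat.factorial k) *
      Real.Gamma ((k : ℝ) + ((q : ℤ) : ℝ) + 1)) =
      (s / 2) ^ (2 * k + q) / (k.factorial * (k + q).factorial) := by
    have h1 : Real.Gamma ((k : ℝ) + ((q : ℤ) : ℝ) + 1) = (k + q).factorial := by
      rw [← Real.Gamma_nat_eq_factorial]
      push_cast
      rfl
    have h2 : (2 * (k : ℤ) + q) = ((2 * k + q : ℕ) : ℤ) := by push_cast; rfl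
    rw [h1, h2, zpow_natCast, zpow_natCast, div_pow, mul_assoc, div_div]
  unfold besselI
  simp only [hterm]
  refine (Summable.of_norm_bounded (g := fun k : ℕ ↦ |s / 2| ^ q * (|s / 2| ^ 2) ^ k / k.factorial)
    ?_ fun k ↦ ?_).hasSum
  · simp only [mul_div_assoc]
    exact (Real.summable_pow_div_factorial _).mul_left _
  · rw [norm_div, norm_pow, Real.norm_eq_abs, pow_add, pow_mul, mul_comm ((|s / 2| ^ 2) ^ k)]
    gcongr
    rw [norm_mul, Real.norm_natCast, Real.norm_natCast]
    exact le_mul_of_one_le_right (by positivity)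
      (by exact_mod_cast Nat.one_le_iff_ne_zero.2 (Nat.factorial_ne_zero _))

lemma div_factorial_le_besselI (q : ℕ) {s : ℝ} (hs : 0 ≤ s) :
    (s / 2) ^ q / q.factorial ≤ besselI q s := by
  have := le_hasSum (hasSum_besselI q s) 0 fun k _ ↦ by positivity
  simpa using this

lemma squareIntegral_besselI_generating (q : ℕ) (s : ℝ) :
    squareIntegral (fun z ↦ cexp (I * s / 2 * z) * cexp (-(I * s / 2) / z) * z ^ (-(q + 1 : ℤ))) =
      2 * π * I * I ^ q * besselI q s := by
  set a : ℂ := I * s / 2 with ha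
  have hexp (w : ℂ) : HasSum (fun n : ℕ ↦ w ^ n / n.factorial) (cexp w) := by
    rw [Complex.exp_eq_exp_ℂ]
    exact NormedSpace.expSeries_div_hasSum_exp w
  have hnorm (w : ℂ) : Summable (fun n : ℕ ↦ ‖w ^ n / n.factorial‖) :=
    NormedSpace.norm_expSeries_div_summable w
  have hprod (u v : ℕ → ℂ) (hu : Summable fun n ↦ ‖u n‖) (hv : Summable fun n ↦ ‖v n‖) :
      Summable fun i : ℕ × ℕ ↦ ‖u i.1‖ * ‖v i.2‖ :=
    hu.mul_of_nonneg hv (fun _ ↦ norm_nonneg _) fun _ ↦ norm_nonneg _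
  have hmul (u v : ℕ → ℂ) (x y : ℂ) (hu : Summable fun n ↦ ‖u n‖) (hv : Summable fun n ↦ ‖v n‖)
      (hx : HasSum u x) (hy : HasSum v y) : HasSum (fun i : ℕ × ℕ ↦ u i.1 * v i.2) (x * y) :=
    hx.mul hy (summable_mul_of_summable_norm hu hv)
  have hsum : HasSum (fun i : ℕ × ℕ ↦ squareIntegral fun z ↦
      (a ^ i.1 / i.1.factorial * ((-a) ^ i.2 / i.2.factorial)) * z ^ (i.1 - i.2 - (q + 1) : ℤ))
      (squareIntegral fun z ↦ cexp (a * z) * cexp (-a / z) * z ^ (-(q + 1 : ℤ))) := by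
    refine hasSum_squareIntegral (b := fun i ↦ ‖(a * 2) ^ i.1 / i.1.factorial‖ *
      ‖(-a) ^ i.2 / i.2.factorial‖) (fun i ↦ ?_) (fun i z hz ↦ ?_) ?_ fun z hz ↦ ?_
    · exact (continuousOn_zpow_squareBoundary _).const_mul _
    · have h1 := one_le_norm_of_mem_squareBoundary hz
      have h2 := norm_le_two_of_mem_squareBoundary hz
      have h3 : ‖z ^ (i.1 - i.2 - (q + 1) : ℤ)‖ ≤ 2 ^ i.1 := by
        rw [norm_zpow]
        calc ‖z‖ ^ (i.1 - i.2 - (q + 1) : ℤ) ≤ ‖z‖ ^ (i.1 : ℤ) := zpow_le_zpow_right₀ h1 (by omega)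
          _ = ‖z‖ ^ i.1 := zpow_natCast _ _
          _ ≤ 2 ^ i.1 := by gcongr
      calc _ ≤ ‖a ^ i.1 / i.1.factorial * ((-a) ^ i.2 / i.2.factorial)‖ * 2 ^ i.1 := by
            rw [norm_mul]
            gcongr
        _ = _ := by
            simp only [norm_mul, norm_div, norm_pow, mul_pow, Complex.norm_ofNat]
            ring
    · have := hprod _ _ (hnorm (a * 2)) (hnorm (-a))
      exact this
    · have hz0 : z ≠ 0 := fun h ↦ zero_notMem_squareBoundary (h ▸ hz)
      have := hmul _ _ _ _ (hnorm _) (hnorm _) (hexp (a * z)) (hexp (-a / z))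
      refine (this.mul_right (z ^ (-(q + 1 : ℤ)))).congr_fun fun i ↦ ?_
      rw [sub_eq_add_neg _ (q + 1 : ℤ), zpow_add₀ hz0, zpow_sub₀ hz0, zpow_natCast, zpow_natCast,
        mul_pow, div_pow]
      ring
  have hval (i : ℕ × ℕ) : (squareIntegral fun z ↦
      (a ^ i.1 / i.1.factorial * ((-a) ^ i.2 / i.2.factorial)) * z ^ (i.1 - i.2 - (q + 1) : ℤ)) =
      if i.1 = i.2 + q then
        (a ^ i.1 / i.1.factorial * ((-a) ^ i.2 / i.2.factorial)) * (2 * π * I) else 0 := by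
    rw [squareIntegral_const_mul]
    split_ifs with h
    · rw [show (i.1 - i.2 - (q + 1) : ℤ) = -1 by rw [h]; push_cast; ring, squareIntegral_inv]
    · rw [squareIntegral_zpow_of_ne (by omega), mul_zero]
  simp only [hval] at hsum
  have hinj : Function.Injective fun k : ℕ ↦ (k + q, k) := fun k l h ↦ (Prod.mk.inj h).2
  rw [← hinj.hasSum_iff] at hsum
  · have hb := (((hasSum_besselI q s).mapL ofRealCLM).mul_left (2 * π * I * I ^ q))
    refine hsum.unique (hb.congr_fun fun k ↦ ?_)
    have hI : a ^ (k + q) * (-a) ^ k = I ^ q * (s / 2) ^ (2 * k + q) := by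
      have : a * -a = (s / 2) ^ 2 := by
        rw [ha]
        linear_combination -(s / 2 : ℂ) ^ 2 * Complex.I_sq
      rw [pow_add, mul_right_comm, ← mul_pow, this, ha, mul_div_assoc, mul_pow, ← pow_mul, pow_add]
      ring
    simp only [Function.comp_apply, if_true, ofRealCLM_apply]
    push_cast
    rw [div_mul_div_comm, hI]
    ring
  · rintro ⟨j, k⟩ hjk
    rw [if_neg]
    exact fun h ↦ hjk ⟨k, Prod.ext h.symm rfl⟩

lemma theta_le_ten {y : ℝ} (h0 : 0 ≤ y) (hy : y ≤ π - 1) : theta y ≤ 10 := by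
  have hπ := Real.pi_gt_three
  have hπ4 := Real.pi_lt_d2
  unfold theta
  split_ifs with hy0
  · norm_num
  have hpos : 0 < y := lt_of_le_of_ne h0 (Ne.symm hy0)
  have hc3 := Real.sin_gt_sub_cube hpos
  rcases le_total y 1 with h1 | h1
  · have hs : 5 / 6 * y ≤ Real.sin y := by nlinarith [pow_le_one₀ h0 h1 (n := 2)]
    have hs' := Real.sin_lt hpos
    have hcos := Real.one_sub_sq_div_two_le_cos (x := y)
    have hcos' := Real.cos_le_one y
    rw [div_le_iff₀ (by nlinarith), Real.sin_two_mul]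
    have hcube : y ^ 3 ≤ y ^ 2 := by nlinarith [sq_nonneg y]
    have : Real.sin y * (1 - Real.cos y) ≤ y * (y ^ 2 / 2) := by
      apply mul_le_mul <;> nlinarith
    have hsq : 25 / 36 * y ^ 2 ≤ Real.sin y ^ 2 := by nlinarith
    nlinarith
  · have hs : 5 / 6 ≤ Real.sin y := by
      have h5 : 5 / 6 ≤ Real.sin 1 := by
        have := Real.sin_gt_sub_cube (x := 1) one_pos
        linarith
      rcases le_total y (π / 2) with h2 | h2
      · exact h5.trans (Real.sin_le_sin_of_le_of_le_pi_div_two (by linarith) h2 h1)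
      · rw [← Real.sin_pi_sub]
        exact h5.trans (Real.sin_le_sin_of_le_of_le_pi_div_two (by linarith) (by linarith)
          (by linarith))
    rw [div_le_iff₀ (by nlinarith)]
    nlinarith [Real.neg_one_le_sin (2 * y)]

lemma abs_pi_div_sub_cot_le {ε : ℝ} (hε0 : 0 < ε) (hε1 : ε ≤ 1) :
    |π / ε - (π - ε) * (Real.cos ε / Real.sin ε)| ≤ 10 := by
  have hπ := Real.pi_gt_three
  have hπ4 := Real.pi_lt_d2
  have hs1 := Real.sin_gt_sub_cube hε0
  have hs2 := Real.sin_lt hε0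
  have hc1 := Real.one_sub_sq_div_two_le_cos (x := ε)
  have hc2 := Real.cos_le_one ε
  set s := Real.sin ε
  set c := Real.cos ε
  have hε2 : ε ^ 2 ≤ 1 := pow_le_one₀ hε0.le hε1
  have hs3 : 5 / 6 * ε ≤ s := by nlinarith
  have hs0 : 0 < s := by linarith
  have e : π / ε - (π - ε) * (c / s) = π * ((s - ε * c) / (ε * s)) + ε * c / s := by
    field_simp
    ring
  have hεc : ε * (1 - c) ≤ ε * (ε ^ 2 / 2) := mul_le_mul_of_nonneg_left (by linarith) hε0.le
  have hεc' : 0 ≤ ε * (1 - c) := mul_nonneg hε0.le (by linarith)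
  have hεs : ε * (5 / 6 * ε) ≤ ε * s := mul_le_mul_of_nonneg_left hs3 hε0.le
  have hcube : ε ^ 3 ≤ ε ^ 2 := pow_le_pow_of_le_one hε0.le hε1 (by norm_num)
  have b1 : |(s - ε * c) / (ε * s)| ≤ 1 := by
    have hpos : 0 < ε ^ 2 := by positivity
    rw [abs_div, abs_of_pos (mul_pos hε0 hs0), div_le_one (by positivity), abs_le]
    constructor <;> linarith
  have hc0 : 0 ≤ c := by linarith
  have b2 : ε * c / s ≤ 2 := by
    rw [div_le_iff₀ hs0]
    linarith
  have b2' : 0 ≤ ε * c / s := by positivity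
  rw [abs_le] at b1 ⊢
  rw [e]
  constructor <;> nlinarith

lemma abs_mul_add_cot_sub_le {ε : ℝ} (hε0 : 0 < ε) (hε1 : ε ≤ 1) :
    |ε * ((π - ε) / Real.sin ε ^ 2 + Real.cos ε / Real.sin ε) - π / ε| ≤ 8 := by
  have hπ := Real.pi_gt_three
  have hπ4 := Real.pi_lt_d2
  have hs1 := Real.sin_gt_sub_cube hε0
  have hs2 := Real.sin_lt hε0
  have hc1 := Real.one_sub_sq_div_two_le_cos (x := ε)
  have hc2 := Real.cos_le_one ε
  set s := Real.sin ε
  set c := Real.cos ε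
  have hε2 : ε ^ 2 ≤ 1 := pow_le_one₀ hε0.le hε1
  have hs3 : 5 / 6 * ε ≤ s := by nlinarith
  have hs0 : 0 < s := by linarith
  have hε3 : 0 < ε ^ 3 := by positivity
  have hss : 25 / 36 * ε ^ 2 ≤ s ^ 2 := by nlinarith
  have e : ε * ((π - ε) / s ^ 2 + c / s) - π / ε =
      π * ((ε - s) * (ε + s) / (ε * s ^ 2)) - ε * ((ε - s * c) / s ^ 2) := by
    field_simp
    ring
  have b1 : (ε - s) * (ε + s) / (ε * s ^ 2) ≤ 1 := by
    rw [div_le_one (by positivity)]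
    have : (ε - s) * (ε + s) ≤ ε ^ 3 / 6 * (2 * ε) :=
      mul_le_mul (by linarith) (by linarith) (by linarith) (by linarith)
    have h4 : ε ^ 4 ≤ ε ^ 3 := pow_le_pow_of_le_one hε0.le hε1 (by norm_num)
    linarith [mul_le_mul_of_nonneg_left hss hε0.le]
  have b1' : 0 ≤ (ε - s) * (ε + s) / (ε * s ^ 2) := by
    have : 0 ≤ ε - s := by linarith
    positivity
  have hsc : s * (1 - c) ≤ ε * (ε ^ 2 / 2) :=
    mul_le_mul (by linarith) (by linarith) (by linarith) (by linarith)
  have hsc' : 0 ≤ s * (1 - c) := mul_nonneg hs0.le (by linarith)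
  have hcube : ε ^ 3 ≤ ε ^ 2 := pow_le_pow_of_le_one hε0.le hε1 (by norm_num)
  have b2 : (ε - s * c) / s ^ 2 ≤ 1 := by
    rw [div_le_one (by positivity)]
    linarith
  have b2' : 0 ≤ (ε - s * c) / s ^ 2 := by
    have : 0 ≤ ε - s * c := by linarith
    positivity
  rw [e, abs_le]
  constructor <;> nlinarith

/-- With `ε = π - y`, the quantity `R y² / sin² y` is the value at the critical point of the phase
`p y + R y cot y`, hence close to `π p - 2 √(π p R)` when `y` is near `π`. -/
lemma abs_phase_sub_le {y R p : ℝ} (hy : π - 1 < y) (hyπ : y < π) (hR : 0 < R) (hp : 0 < p)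
    (hθ : theta y = p / R) :
    |R * (y / Real.sin y) ^ 2 + 2 * √(π * p * R) - π * p| ≤ 20 * R := by
  have hπ := Real.pi_gt_three
  have hπ4 := Real.pi_lt_d2
  obtain ⟨ε, rfl⟩ : ∃ ε, y = π - ε := ⟨π - y, by ring⟩
  have hε0 : 0 < ε := by linarith
  have hε1 : ε < 1 := by linarith
  unfold theta at hθ
  rw [if_neg (by linarith), Real.sin_two_mul, Real.sin_pi_sub, Real.cos_pi_sub] at hθ
  rw [Real.sin_pi_sub]
  have hs0 : 0 < Real.sin ε := Real.sin_pos_of_pos_of_lt_pi hε0 (by linarith)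
  set s := Real.sin ε
  set c := Real.cos ε
  have hp_eq : p = R * ((π - ε) / s ^ 2 + c / s) := by
    field_simp at hθ ⊢
    linear_combination -hθ
  have hη : |p * ε - R * π / ε| ≤ 8 * R := by
    have e : p * ε - R * π / ε = R * (ε * ((π - ε) / s ^ 2 + c / s) - π / ε) := by
      rw [hp_eq]
      ring
    rw [e, abs_mul, abs_of_pos hR, mul_comm]
    exact mul_le_mul_of_nonneg_right (abs_mul_add_cot_sub_le hε0 hε1.le) hR.le
  have hbr := abs_pi_div_sub_cot_le hε0 hε1.le
  have hsq : 2 * √(π * p * R) = 2 * (√(p * ε) * √(R * π / ε)) := by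
    rw [← Real.sqrt_mul (by positivity)]
    congr 2
    field_simp
  have ha := Real.sq_sqrt (show 0 ≤ p * ε by positivity)
  have hb := Real.sq_sqrt (show 0 ≤ R * π / ε by positivity)
  have ha0 := Real.sqrt_nonneg (p * ε)
  have hb0 := Real.sqrt_nonneg (R * π / ε)
  have hamgm : |p * ε + R * π / ε - 2 * √(π * p * R)| ≤ 8 * R := by
    refine le_trans ?_ hη
    rw [hsq]
    set A := √(p * ε)
    set B := √(R * π / ε)
    rw [← ha, ← hb, show A ^ 2 + B ^ 2 - 2 * (A * B) = (A - B) ^ 2 by ring, abs_sq,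
      show A ^ 2 - B ^ 2 = (A + B) * (A - B) by ring, abs_mul, abs_of_nonneg (add_nonneg ha0 hb0),
      ← sq_abs, sq]
    refine mul_le_mul_of_nonneg_right ?_ (abs_nonneg _)
    rw [abs_le]
    constructor <;> linarith
  have hfin : R * ((π - ε) / s) ^ 2 + 2 * √(π * p * R) - π * p =
      -(p * ε + R * π / ε - 2 * √(π * p * R)) + R * (π / ε - (π - ε) * (c / s)) := by
    have : R * ((π - ε) / s) ^ 2 = p * (π - ε) - R * (π - ε) * (c / s) := by
      rw [hp_eq]
      field_simp
      ring
    rw [this]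
    ring
  rw [hfin]
  refine (abs_add_le _ _).trans ?_
  rw [abs_neg, abs_mul, abs_of_pos hR]
  nlinarith

/-- The entire function `sinh z / z`. -/
noncomputable def sinhc (z : ℂ) : ℂ := dslope Complex.sinh 0 z

lemma sinhc_zero : sinhc 0 = 1 := by
  simp [sinhc]

lemma mul_sinhc (z : ℂ) : z * sinhc z = Complex.sinh z := by
  simpa [sinhc] using sub_smul_dslope Complex.sinh 0 z

lemma sinhc_of_ne {z : ℂ} (hz : z ≠ 0) : sinhc z = Complex.sinh z / z := by
  rw [← mul_sinhc, mul_div_cancel_left₀ _ hz]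

lemma differentiable_sinhc : Differentiable ℂ sinhc := by
  rw [← differentiableOn_univ]
  exact (Complex.differentiableOn_dslope Filter.univ_mem).2
    Complex.differentiable_sinh.differentiableOn

lemma sinh_add_mul_I_eq (s y : ℝ) : Complex.sinh (s + y * I) =
    (Real.sinh s * Real.cos y : ℝ) + (Real.cosh s * Real.sin y : ℝ) * I := by
  rw [Complex.sinh_add, Complex.sinh_mul_I, Complex.cosh_mul_I]
  push_cast
  ring

lemma cosh_add_mul_I_eq (s y : ℝ) : Complex.cosh (s + y * I) =
    (Real.cosh s * Real.cos y : ℝ) + (Real.sinh s * Real.sin y : ℝ) * I := by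
  rw [Complex.cosh_add, Complex.sinh_mul_I, Complex.cosh_mul_I]
  push_cast
  ring

lemma norm_sinh_add_mul_I_sq (s y : ℝ) :
    ‖Complex.sinh (s + y * I)‖ ^ 2 = Real.sinh s ^ 2 + Real.sin y ^ 2 := by
  rw [Complex.sq_norm, sinh_add_mul_I_eq, Complex.normSq_add_mul_I]
  linear_combination Real.sin y ^ 2 * Real.cosh_sq s + Real.sinh s ^ 2 * Real.sin_sq_add_cos_sq y

lemma norm_cosh_add_mul_I_le (s y : ℝ) : ‖Complex.cosh (s + y * I)‖ ≤ Real.cosh s := by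
  refine (sq_le_sq₀ (norm_nonneg _) (Real.cosh_pos s).le).1 ?_
  rw [Complex.sq_norm, cosh_add_mul_I_eq, Complex.normSq_add_mul_I]
  nlinarith [Real.cosh_sq s, Real.sin_sq_add_cos_sq y, sq_nonneg (Real.sin y)]

lemma re_mul_coth (s y : ℝ) :
    ((s + y * I) * Complex.cosh (s + y * I) / Complex.sinh (s + y * I)).re =
      (s * (Real.sinh s * Real.cosh s) + y * (Real.sin y * Real.cos y)) /
        ‖Complex.sinh (s + y * I)‖ ^ 2 := by
  rw [Complex.div_re, Complex.sq_norm, ← add_div]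
  congr 1
  rw [sinh_add_mul_I_eq, cosh_add_mul_I_eq]
  simp only [mul_re, mul_im, add_re, add_im, ofReal_re, ofReal_im, I_re, I_im]
  linear_combination (s * Real.sinh s * Real.cosh s) * Real.sin_sq_add_cos_sq y
    + y * Real.sin y * Real.cos y * Real.cosh_sq s

lemma sinhc_ne_zero {z : ℂ} (h0 : 0 ≤ z.im) (h1 : z.im ≤ 3 * π / 2) (hz : z ≠ π * I) :
    sinhc z ≠ 0 := by
  intro h
  have hz0 : z ≠ 0 := by
    rintro rfl
    simp [sinhc_zero] at h
  have hs : Complex.sinh (z.re + z.im * I) = 0 := by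
    rw [Complex.re_add_im, ← mul_sinhc, h, mul_zero]
  have hn := norm_sinh_add_mul_I_sq z.re z.im
  rw [hs, norm_zero] at hn
  have h2 : Real.sinh z.re = 0 := by
    nlinarith [sq_nonneg (Real.sinh z.re), sq_nonneg (Real.sin z.im)]
  have h3 : Real.sin z.im = 0 := by
    nlinarith [sq_nonneg (Real.sinh z.re), sq_nonneg (Real.sin z.im)]
  rw [Real.sinh_eq_zero] at h2
  obtain ⟨k, hk⟩ := Real.sin_eq_zero_iff.1 h3
  have hπ := Real.pi_pos
  have hk0 : 0 ≤ k := by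
    have : (-1 : ℝ) < k := by nlinarith
    have : (-1 : ℤ) < k := by exact_mod_cast this
    omega
  have hk2 : k < 2 := by
    have : (k : ℝ) < 2 := by nlinarith
    exact_mod_cast this
  interval_cases k
  · refine hz0 (Complex.ext h2 ?_)
    simpa using hk.symm
  · refine hz (Complex.ext ?_ ?_)
    · simpa using h2
    · simpa using hk.symm

/-- The integrand in the definition of `pH`, extended to the complex plane. -/
noncomputable def heatIntegrand (n k₁ k₂ : ℕ) (R p : ℝ) (z : ℂ) : ℂ :=
  cexp (I * z * p - R * (Complex.cosh z / sinhc z)) *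
    (z ^ k₂ * Complex.cosh z ^ k₁ / sinhc z ^ (n + k₁))

lemma heatIntegrand_of_ne (n k₁ k₂ : ℕ) (R p : ℝ) {z : ℂ} (hz : z ≠ 0) :
    heatIntegrand n k₁ k₂ R p z =
      cexp (I * z * p - R * (z * Complex.cosh z / Complex.sinh z)) *
        (z ^ (n + k₁ + k₂) * Complex.cosh z ^ k₁ / Complex.sinh z ^ (n + k₁)) := by
  unfold heatIntegrand
  rw [sinhc_of_ne hz]
  congr 1
  · congr 2
    rw [div_div_eq_mul_div, mul_comm z]
  · rw [div_pow, div_div_eq_mul_div]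
    ring

lemma pH_eq (n k₁ k₂ : ℕ) (x : EuclideanSpace ℝ (Fin (2 * n))) (t : ℝ) :
    pH n k₁ k₂ x t = (2 * (-1 : ℂ) ^ k₁ * Complex.I ^ k₂ / (4 * (π : ℂ)) ^ (n + 1)) *
      ∫ s : ℝ, heatIntegrand n k₁ k₂ (‖x‖ ^ 2 / 4) |t| s := by
  unfold pH
  congr 2
  ext s
  split_ifs with h h'
  · subst h h'
    simp [heatIntegrand, sinhc_zero]
  · subst h
    simp [heatIntegrand, h']
  · rw [heatIntegrand_of_ne _ _ _ _ _ (by exact_mod_cast h : (s : ℂ) ≠ 0)]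
    push_cast
    congr 2
    ring

lemma differentiableAt_heatIntegrand (n k₁ k₂ : ℕ) (R p : ℝ) {z : ℂ} (hz : sinhc z ≠ 0) :
    DifferentiableAt ℂ (heatIntegrand n k₁ k₂ R p) z := by
  have h := differentiable_sinhc z
  unfold heatIntegrand
  have : sinhc z ^ (n + k₁) ≠ 0 := pow_ne_zero _ hz
  fun_prop (disch := assumption)

lemma pow_div_cosh_le (N : ℕ) (s : ℝ) :
    (|s| + 5) ^ N / Real.cosh s ≤ 2 * (N + 2).factorial * rexp 5 * (1 + s ^ 2)⁻¹ := by
  have h1 := Real.pow_div_factorial_le_exp (|s| + 5) (by positivity) (N + 2)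
  have h2 : rexp (|s| + 5) ≤ 2 * Real.cosh s * rexp 5 := by
    rw [Real.exp_add]
    gcongr
    rw [← Real.cosh_abs, Real.cosh_eq]
    linarith [Real.exp_pos (-|s|)]
  have h3 : 1 + s ^ 2 ≤ (|s| + 5) ^ 2 := by nlinarith [abs_nonneg s, sq_abs s]
  rw [div_le_iff₀ (by positivity)] at h1
  rw [← div_eq_mul_inv, div_le_div_iff₀ (Real.cosh_pos s) (by positivity)]
  calc (|s| + 5) ^ N * (1 + s ^ 2) ≤ (|s| + 5) ^ N * (|s| + 5) ^ 2 := by gcongr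
    _ = (|s| + 5) ^ (N + 2) := by ring
    _ ≤ rexp (|s| + 5) * (N + 2).factorial := h1
    _ ≤ 2 * Real.cosh s * rexp 5 * (N + 2).factorial := by gcongr
    _ = _ := by ring

lemma norm_heatIntegrand_le {n : ℕ} (hn : 1 ≤ n) (k₁ k₂ : ℕ) {R p s y b : ℝ} (hR : 0 ≤ R)
    (hy0 : 0 ≤ y) (hy : y ≤ 3 * π / 2)
    (hsinh : Real.cosh s ≤ 2 * ‖Complex.sinh (s + y * I)‖)
    (hre : -b ≤ ((s + y * I) * Complex.cosh (s + y * I) / Complex.sinh (s + y * I)).re) :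
    ‖heatIntegrand n k₁ k₂ R p (s + y * I)‖ ≤ rexp (-p * y + R * b) *
      (2 ^ (n + k₁) * (2 * (n + k₁ + k₂ + 2).factorial * rexp 5)) * (1 + s ^ 2)⁻¹ := by
  have hc := Real.cosh_pos s
  have hc1 := Real.one_le_cosh s
  have hpos : 0 < ‖Complex.sinh (s + y * I)‖ := by linarith
  have hz : (s + y * I : ℂ) ≠ 0 := by
    intro h
    simp [h] at hpos
  have hπ4 := Real.pi_lt_d2
  have hnz : ‖(s + y * I : ℂ)‖ ≤ |s| + 5 := by
    refine (norm_add_le _ _).trans ?_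
    simp only [norm_mul, norm_I, norm_real, Real.norm_eq_abs, abs_of_nonneg hy0]
    linarith
  rw [heatIntegrand_of_ne _ _ _ _ _ hz, norm_mul, Complex.norm_exp]
  set z : ℂ := s + y * I with hzdef
  have hre' : (I * z * p - R * (z * Complex.cosh z / Complex.sinh z)).re ≤ -p * y + R * b := by
    rw [sub_re, re_ofReal_mul]
    have : (I * z * p).re = -p * y := by
      simp [hzdef]
      ring
    rw [this]
    nlinarith
  have hnc := norm_cosh_add_mul_I_le s y
  rw [← hzdef] at hnc
  have hmain : ‖z ^ (n + k₁ + k₂) * Complex.cosh z ^ k₁ / Complex.sinh z ^ (n + k₁)‖ ≤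
      2 ^ (n + k₁) * (2 * (n + k₁ + k₂ + 2).factorial * rexp 5) * (1 + s ^ 2)⁻¹ := by
    rw [norm_div, norm_mul, norm_pow, norm_pow, norm_pow]
    calc ‖z‖ ^ (n + k₁ + k₂) * ‖Complex.cosh z‖ ^ k₁ / ‖Complex.sinh z‖ ^ (n + k₁)
        ≤ (|s| + 5) ^ (n + k₁ + k₂) * Real.cosh s ^ k₁ / (Real.cosh s / 2) ^ (n + k₁) := by
          gcongr
          linarith
      _ = 2 ^ (n + k₁) * ((|s| + 5) ^ (n + k₁ + k₂) / Real.cosh s ^ n) := by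
          rw [div_pow, pow_add (Real.cosh s)]
          field_simp
      _ ≤ 2 ^ (n + k₁) * ((|s| + 5) ^ (n + k₁ + k₂) / Real.cosh s) := by
          gcongr
          exact le_self_pow₀ hc1 (by omega)
      _ ≤ 2 ^ (n + k₁) * (2 * (n + k₁ + k₂ + 2).factorial * rexp 5 * (1 + s ^ 2)⁻¹) := by
          gcongr
          exact pow_div_cosh_le _ _
      _ = _ := by ring
  rw [mul_assoc (rexp _)]
  exact mul_le_mul (Real.exp_le_exp.2 hre') hmain (norm_nonneg _) (Real.exp_pos _).le

lemma norm_heatIntegrand_le_of_one_le_abs {n : ℕ} (hn : 1 ≤ n) (k₁ k₂ : ℕ) {R p s y : ℝ}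
    (hR : 0 ≤ R) (hp : 0 ≤ p) (hs : 1 ≤ |s|) (hy0 : 0 ≤ y) (hy : y ≤ 3 * π / 2) :
    ‖heatIntegrand n k₁ k₂ R p (s + y * I)‖ ≤ rexp (R * 5) *
      (2 ^ (n + k₁) * (2 * (n + k₁ + k₂ + 2).factorial * rexp 5)) * (1 + s ^ 2)⁻¹ := by
  have hπ4 := Real.pi_lt_d2
  have h1 : 1 ≤ Real.sinh s ^ 2 := by
    rw [← sq_abs, Real.abs_sinh]
    exact one_le_pow₀ (hs.trans (Real.self_le_sinh_iff.2 (abs_nonneg s)))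
  have hn2 := norm_sinh_add_mul_I_sq s y
  have h2 : 1 ≤ ‖Complex.sinh (s + y * I)‖ ^ 2 := by
    nlinarith [sq_nonneg (Real.sin y)]
  refine (norm_heatIntegrand_le hn k₁ k₂ (b := 5) hR hy0 hy ?_ ?_).trans ?_
  · refine (sq_le_sq₀ (Real.cosh_pos s).le (by positivity)).1 ?_
    rw [mul_pow, hn2, Real.cosh_sq]
    nlinarith [sq_nonneg (Real.sin y)]
  · rw [re_mul_coth, le_div_iff₀ (by linarith)]
    have h3 : 0 ≤ s * (Real.sinh s * Real.cosh s) := by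
      have : 0 ≤ s * Real.sinh s := by
        rcases le_total 0 s with h | h
        · exact mul_nonneg h (Real.sinh_nonneg_iff.2 h)
        · exact mul_nonneg_of_nonpos_of_nonpos h (Real.sinh_nonpos_iff.2 h)
      rw [← mul_assoc]
      exact mul_nonneg this (Real.cosh_pos s).le
    have h4 : -1 ≤ Real.sin y * Real.cos y := by
      nlinarith [sq_nonneg (Real.sin y + Real.cos y), Real.sin_sq_add_cos_sq y]
    nlinarith
  · gcongr
    nlinarith

lemma norm_heatIntegrand_shift_le {n : ℕ} (hn : 1 ≤ n) (k₁ k₂ : ℕ) {R p : ℝ} (s : ℝ)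
    (hR : 0 ≤ R) :
    ‖heatIntegrand n k₁ k₂ R p (s + (3 * π / 2 : ℝ) * I)‖ ≤ rexp (-p * (3 * π / 2)) *
      (2 ^ (n + k₁) * (2 * (n + k₁ + k₂ + 2).factorial * rexp 5)) * (1 + s ^ 2)⁻¹ := by
  have hπ := Real.pi_pos
  have hsin : Real.sin (3 * π / 2) = -1 := by
    rw [show 3 * π / 2 = π / 2 + π by ring, Real.sin_add_pi, Real.sin_pi_div_two]
  have hcos : Real.cos (3 * π / 2) = 0 := by
    rw [show 3 * π / 2 = π / 2 + π by ring, Real.cos_add_pi, Real.cos_pi_div_two, neg_zero]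
  have hn2 := norm_sinh_add_mul_I_sq s (3 * π / 2)
  rw [hsin] at hn2
  have := norm_heatIntegrand_le hn k₁ k₂ (p := p) (s := s) (b := 0) hR
    (by positivity : 0 ≤ 3 * π / 2) le_rfl ?_ ?_
  · rwa [mul_zero, add_zero] at this
  · refine (sq_le_sq₀ (Real.cosh_pos s).le (by positivity)).1 ?_
    rw [mul_pow, hn2, Real.cosh_sq]
    nlinarith [sq_nonneg (Real.sinh s)]
  · rw [re_mul_coth, hcos, mul_zero, mul_zero, add_zero, neg_zero]
    have : 0 ≤ s * Real.sinh s := by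
      rcases le_total 0 s with h | h
      · exact mul_nonneg h (Real.sinh_nonneg_iff.2 h)
      · exact mul_nonneg_of_nonpos_of_nonpos h (Real.sinh_nonpos_iff.2 h)
    rw [← mul_assoc]
    exact div_nonneg (mul_nonneg this (Real.cosh_pos s).le) (sq_nonneg _)

lemma norm_integral_heatIntegrand_shift_le {n : ℕ} (hn : 1 ≤ n) (k₁ k₂ : ℕ) {R p : ℝ}
    (hR : 0 ≤ R) :
    ‖∫ s : ℝ, heatIntegrand n k₁ k₂ R p (s + (3 * π / 2 : ℝ) * I)‖ ≤ rexp (-p * (3 * π / 2)) *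
      (2 ^ (n + k₁) * (2 * (n + k₁ + k₂ + 2).factorial * rexp 5)) * π := by
  refine (norm_integral_le_of_norm_le (integrable_inv_one_add_sq.const_mul _)
    (.of_forall fun s ↦ norm_heatIntegrand_shift_le hn k₁ k₂ s hR)).trans ?_
  rw [integral_const_mul, integral_univ_inv_one_add_sq]

lemma integral_heatIntegrand_eq {n : ℕ} (hn : 1 ≤ n) (k₁ k₂ : ℕ) {R p r : ℝ} (hR : 0 ≤ R)
    (hp : 0 ≤ p) (hr : 0 < r) (hr1 : r < 1) :
    ∫ s : ℝ, heatIntegrand n k₁ k₂ R p s =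
      r * squareIntegral (fun z ↦ heatIntegrand n k₁ k₂ R p (π * I + r * z)) +
        ∫ s : ℝ, heatIntegrand n k₁ k₂ R p (s + (3 * π / 2 : ℝ) * I) := by
  have hπ := Real.pi_gt_three
  rw [← integral_sub_integral_shift_eq_squareIntegral (h := π) (H := 3 * π / 2) hr (by linarith)
    (by linarith) (fun z h0 h1 hz ↦ differentiableAt_heatIntegrand _ _ _ _ _
    (sinhc_ne_zero h0 h1 hz)) fun s y hs h0 h1 ↦
    norm_heatIntegrand_le_of_one_le_abs hn k₁ k₂ hR hp hs h0 h1]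
  ring

/-- The factor of `heatIntegrand n k₁ k₂ R p (π * I + w)` which is regular at `w = 0`. -/
noncomputable def regularFactor (n k₁ k₂ : ℕ) (R : ℝ) (w : ℂ) : ℂ :=
  cexp (-(R * (Complex.cosh w / sinhc w +
      π * I * dslope (fun u ↦ Complex.cosh u / sinhc u) 0 w))) *
    ((π * I + w) ^ (n + k₁ + k₂) * Complex.cosh w ^ k₁ / sinhc w ^ (n + k₁))

lemma heatIntegrand_pi_mul_I_add (n k₁ k₂ : ℕ) (R p : ℝ) {w : ℂ} (hw : w ≠ 0)
    (hw' : π * I + w ≠ 0) :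
    heatIntegrand n k₁ k₂ R p (π * I + w) =
      rexp (-(π * p)) * (-1) ^ n * (w ^ (n + k₁))⁻¹ * (cexp (I * p * w) * cexp (-(R * π * I) / w)) *
        regularFactor n k₁ k₂ R w := by
  have hexp : cexp (I * (π * I + w) * p - R * ((π * I + w) * Complex.cosh (π * I + w) /
      Complex.sinh (π * I + w))) = rexp (-(π * p)) * (cexp (I * p * w) * cexp (-(R * π * I) / w)) *
      cexp (-(R * (Complex.cosh w / sinhc w +
      π * I * dslope (fun u ↦ Complex.cosh u / sinhc u) 0 w))) := by
    rw [Complex.ofReal_exp, ← Complex.exp_add, ← Complex.exp_add, ← Complex.exp_add]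
    congr 1
    rw [dslope_of_ne _ hw, slope_def_field, Complex.cosh_zero, sinhc_zero, div_one, sub_zero,
      Complex.cosh_add, Complex.sinh_add, Complex.sinh_mul_I, Complex.cosh_mul_I,
      Complex.sin_pi, Complex.cos_pi, ← mul_sinhc w]
    have h : (π * I + w) * (-1 * Complex.cosh w + 0 * I * (w * sinhc w)) /
        (0 * I * Complex.cosh w + -1 * (w * sinhc w)) =
        π * I / w + (Complex.cosh w / sinhc w +
          π * I * ((Complex.cosh w / sinhc w - 1) / w)) := by
      rw [show (-1 * Complex.cosh w + 0 * I * (w * sinhc w)) = -Complex.cosh w by ring,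
        show (0 * I * Complex.cosh w + -1 * (w * sinhc w)) = -(w * sinhc w) by ring, mul_neg,
        neg_div_neg_eq, mul_div_mul_comm, add_div, div_self hw]
      ring
    rw [h]
    push_cast
    linear_combination (π * p : ℂ) * Complex.I_sq
  rw [heatIntegrand_of_ne _ _ _ _ _ hw', hexp, regularFactor]
  have hs : Complex.sinh (π * I + w) = -(w * sinhc w) := by
    rw [mul_sinhc, Complex.sinh_add, Complex.sinh_mul_I, Complex.cosh_mul_I, Complex.sin_pi,
      Complex.cos_pi]
    ring
  have hc : Complex.cosh (π * I + w) = -Complex.cosh w := by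
    rw [Complex.cosh_add, Complex.sinh_mul_I, Complex.cosh_mul_I, Complex.sin_pi, Complex.cos_pi]
    ring
  have hsign : ((-1 : ℂ) ^ (n + k₁))⁻¹ * (-1) ^ k₁ = (-1) ^ n := by
    rw [← inv_pow, inv_neg, inv_one, ← pow_add, add_assoc, pow_add, ← two_mul, pow_mul,
      neg_one_sq, one_pow, mul_one]
  rw [hs, hc, neg_pow (w * sinhc w), neg_pow (Complex.cosh w), mul_pow, ← hsign]
  simp only [div_eq_mul_inv, mul_inv]
  ring

lemma exists_norm_regularFactor_sub_le (n k₁ k₂ : ℕ) :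
    ∃ ρ > 0, ∃ K > 0, ∀ (w : ℂ) (R : ℝ), ‖w‖ ≤ ρ → 0 ≤ R → R ≤ ρ →
      ‖regularFactor n k₁ k₂ R w - (π * I) ^ (n + k₁ + k₂)‖ ≤ K * (‖w‖ + R) := by
  set A : ℂ → ℂ := fun w ↦ Complex.cosh w / sinhc w +
    π * I * dslope (fun u ↦ Complex.cosh u / sinhc u) 0 w
  set B : ℂ → ℂ := fun w ↦ (π * I + w) ^ (n + k₁ + k₂) * Complex.cosh w ^ k₁ / sinhc w ^ (n + k₁)
  have hS : sinhc 0 ≠ 0 := by simp [sinhc_zero]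
  have hSm : sinhc 0 ^ (n + k₁) ≠ 0 := pow_ne_zero _ hS
  have hSd := differentiable_sinhc 0
  have hq : DifferentiableAt ℂ (fun u ↦ Complex.cosh u / sinhc u) 0 := by
    fun_prop (disch := assumption)
  have hA : ContinuousAt A 0 :=
    hq.continuousAt.add ((continuousAt_dslope_same.2 hq).const_mul _)
  have hB : DifferentiableAt ℂ B 0 := by
    fun_prop (disch := assumption)
  have hB0 : B 0 = (π * I) ^ (n + k₁ + k₂) := by simp [B, sinhc_zero]
  obtain ⟨b, hb0, hb⟩ := hB.isBigO_sub.exists_pos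
  have hev := hb.bound.and (hA.norm.eventually (gt_mem_nhds (lt_add_one ‖A 0‖)))
  obtain ⟨ε, hε, hball⟩ := Metric.eventually_nhds_iff.1 hev
  set a := ‖A 0‖ + 1 with ha
  have ha0 : 0 < a := by positivity
  refine ⟨min (ε / 2) (1 / a), by positivity, 2 * a * (‖B 0‖ + b * (ε / 2)) + b, by positivity,
    fun w R hw hR hRρ ↦ ?_⟩
  have hwε : ‖w‖ ≤ ε / 2 := hw.trans (min_le_left _ _)
  obtain ⟨h1, h2⟩ := hball (y := w) (by rw [dist_zero_right]; linarith)
  rw [sub_zero] at h1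
  have hRa : R * a ≤ 1 := (le_div_iff₀ ha0).1 (hRρ.trans (min_le_right _ _))
  have hnorm : ‖-(R * A w)‖ ≤ R * a := by
    rw [norm_neg, norm_mul, norm_real, Real.norm_of_nonneg hR]
    gcongr
  have he : ‖cexp (-(R * A w)) - 1‖ ≤ 2 * (R * a) :=
    (Complex.norm_exp_sub_one_le (hnorm.trans hRa)).trans (by gcongr)
  have hBw : ‖B w‖ ≤ ‖B 0‖ + b * (ε / 2) := by
    have : ‖B w‖ ≤ ‖B 0‖ + ‖B w - B 0‖ := by
      simpa using norm_add_le (B 0) (B w - B 0)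
    have h3 : b * ‖w‖ ≤ b * (ε / 2) := by gcongr
    linarith
  have heq : regularFactor n k₁ k₂ R w - (π * I) ^ (n + k₁ + k₂) =
      (cexp (-(R * A w)) - 1) * B w + (B w - B 0) := by
    rw [hB0]
    simp only [regularFactor, A, B]
    ring
  rw [heq]
  refine (norm_add_le _ _).trans ?_
  rw [norm_mul]
  have h4 : ‖cexp (-(R * A w)) - 1‖ * ‖B w‖ ≤ 2 * (R * a) * (‖B 0‖ + b * (ε / 2)) := by
    gcongr
  have h5 : 0 ≤ 2 * a * (‖B 0‖ + b * (ε / 2)) * ‖w‖ := by positivity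
  have h6 : 0 ≤ b * R := by positivity
  linarith

lemma exists_norm_squareIntegral_sub_le (n k₁ k₂ q : ℕ) (hq : n + k₁ = q + 1) {C : ℝ}
    (hC : 0 < C) :
    ∃ ρ > 0, ∃ K > 0, ∀ δ κ : ℝ, 0 < δ → δ ≤ ρ → 0 ≤ κ → κ ≤ C →
      ‖(π * δ : ℝ) * squareIntegral (fun z ↦ heatIntegrand n k₁ k₂ (κ * δ / 2) (κ / (2 * π * δ))
          (π * I + (π * δ : ℝ) * z)) -
        rexp (-(π * (κ / (2 * π * δ)))) * (-1) ^ n * (((π * δ) ^ q)⁻¹ : ℝ) *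
          (π * I) ^ (n + k₁ + k₂) * (2 * π * I * I ^ q * besselI q κ)‖ ≤
      K * δ * (rexp (-(π * (κ / (2 * π * δ)))) * ((π * δ) ^ q)⁻¹) := by
  obtain ⟨ρ, hρ, K, hK, hreg⟩ := exists_norm_regularFactor_sub_le n k₁ k₂
  have hπ := Real.pi_pos
  have hπ4 := Real.pi_lt_d2
  refine ⟨min (1 / 10) (min (ρ / (2 * π)) (ρ / C)), by positivity,
    8 * (rexp (2 * C) * (K * (2 * π + C))), by positivity, fun δ κ hδ hδρ hκ hκC ↦ ?_⟩
  set r : ℝ := π * δ with hr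
  set p : ℝ := κ / (2 * π * δ) with hp
  set R : ℝ := κ * δ / 2 with hR
  have hδ1 : δ ≤ 1 / 10 := hδρ.trans (min_le_left _ _)
  have hδ2 : δ * (2 * π) ≤ ρ :=
    (le_div_iff₀ (by positivity)).1 (hδρ.trans ((min_le_right _ _).trans (min_le_left _ _)))
  have hδ3 : δ * C ≤ ρ :=
    (le_div_iff₀ (by positivity)).1 (hδρ.trans ((min_le_right _ _).trans (min_le_right _ _)))
  have hr0 : 0 < r := by positivity
  have hr0' : (r : ℂ) ≠ 0 := by exact_mod_cast hr0.ne'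
  have hr1 : r < 1 / 2 := by nlinarith
  have hR0 : 0 ≤ R := by positivity
  have hRC : R ≤ C * δ := by
    rw [hR]
    nlinarith [mul_le_mul_of_nonneg_right hκC hδ.le, mul_pos hC hδ]
  have hpr : p * r = κ / 2 := by
    rw [hp, hr]
    field_simp
  have hRr : R * π / r = κ / 2 := by
    rw [hR, hr]
    field_simp
  set M : ℂ → ℂ := fun z ↦ cexp (I * κ / 2 * z) * cexp (-(I * κ / 2) / z) * z ^ (-(q + 1 : ℤ))
    with hM
  set E : ℂ := rexp (-(π * p)) * (-1) ^ n * ((r : ℂ) ^ (n + k₁))⁻¹ with hE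
  have hne {z : ℂ} (hz : z ∈ squareBoundary) : z ≠ 0 :=
    fun h ↦ zero_notMem_squareBoundary (h ▸ hz)
  have hrz {z : ℂ} (hz : z ∈ squareBoundary) : ‖r * z‖ ≤ 2 * r := by
    rw [norm_mul, norm_real, Real.norm_of_nonneg hr0.le, mul_comm]
    exact mul_le_mul_of_nonneg_right (norm_le_two_of_mem_squareBoundary hz) hr0.le
  have him {z : ℂ} (hz : z ∈ squareBoundary) :
      0 ≤ (π * I + r * z).im ∧ (π * I + r * z).im ≤ 3 * π / 2 := by
    have h1 := (Complex.abs_im_le_norm (r * z)).trans (hrz hz)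
    rw [abs_le] at h1
    have h2 : (π * I + r * z).im = π + (r * z).im := by simp
    have h3 := Real.pi_gt_three
    rw [h2]
    constructor <;> linarith
  have hF {z : ℂ} (hz : z ∈ squareBoundary) : heatIntegrand n k₁ k₂ R p (π * I + r * z) =
      E * (M z * regularFactor n k₁ k₂ R (r * z)) := by
    have hz0 := hne hz
    rw [heatIntegrand_pi_mul_I_add n k₁ k₂ R p (mul_ne_zero hr0' hz0), hE, hM]
    · have e1 : I * p * (r * z) = I * κ / 2 * z := by
        have : (p * r : ℂ) = κ / 2 := by exact_mod_cast hpr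
        linear_combination I * z * this
      have e2 : -(R * π * I) / (r * z) = -(I * κ / 2) / z := by
        have : (R * π / r : ℂ) = κ / 2 := by exact_mod_cast hRr
        have h' : -(R * π * I) / (r * z) = -(I * (R * π / r)) / z := by
          field_simp
        rw [h', this]
        ring
      have e3 : z ^ (-(q + 1 : ℤ)) = (z ^ (n + k₁))⁻¹ := by
        rw [hq, zpow_neg]
        norm_cast
      beta_reduce
      rw [e1, e2, e3, mul_pow, mul_inv]
      ring
    · intro h
      have h1 : ‖(π * I : ℂ)‖ = ‖r * z‖ := by
        rw [eq_neg_of_add_eq_zero_left h, norm_neg]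
      have h2 : ‖(π * I : ℂ)‖ = π := by simp [abs_of_pos hπ]
      have h3 := hrz hz
      have h4 := Real.pi_gt_three
      linarith
  have hFc : ContinuousOn (fun z ↦ heatIntegrand n k₁ k₂ R p (π * I + r * z)) squareBoundary := by
    intro z hz
    refine ContinuousAt.continuousWithinAt ?_
    refine ContinuousAt.comp (f := fun z : ℂ ↦ π * I + r * z) (g := heatIntegrand n k₁ k₂ R p)
      (differentiableAt_heatIntegrand _ _ _ _ _ (sinhc_ne_zero (him hz).1 (him hz).2 ?_)
      ).continuousAt (by fun_prop)
    simpa [hr0.ne'] using hne hz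
  have hMc : ContinuousOn M squareBoundary := by
    have h1 : ContinuousOn (fun z : ℂ ↦ -(I * κ / 2) / z) squareBoundary :=
      continuousOn_const.div continuousOn_id fun z hz ↦ hne hz
    have h2 : Continuous fun z : ℂ ↦ cexp (I * κ / 2 * z) := by fun_prop
    exact (h2.continuousOn.mul h1.cexp).mul (continuousOn_zpow_squareBoundary _)
  have hMn {z : ℂ} (hz : z ∈ squareBoundary) : ‖M z‖ ≤ rexp (2 * C) := by
    have h1 := one_le_norm_of_mem_squareBoundary hz
    have h2 := norm_le_two_of_mem_squareBoundary hz
    have hIk : ‖I * κ / 2‖ = κ / 2 := by simp [abs_of_nonneg hκ]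
    have h3 : ‖cexp (I * κ / 2 * z)‖ ≤ rexp C := by
      refine (Complex.norm_exp_le_exp_norm _).trans (Real.exp_le_exp.2 ?_)
      rw [norm_mul, hIk]
      nlinarith
    have h4 : ‖cexp (-(I * κ / 2) / z)‖ ≤ rexp C := by
      refine (Complex.norm_exp_le_exp_norm _).trans (Real.exp_le_exp.2 ?_)
      rw [norm_div, norm_neg, hIk, div_le_iff₀ (by linarith)]
      nlinarith
    have h5 : ‖z ^ (-(q + 1 : ℤ))‖ ≤ 1 := by
      rw [norm_zpow]
      exact zpow_le_one_of_nonpos₀ h1 (by omega)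
    rw [hM, norm_mul, norm_mul, two_mul, Real.exp_add]
    calc _ ≤ rexp C * rexp C * 1 := by gcongr
      _ = _ := mul_one _
  have hmain : squareIntegral (fun z ↦ heatIntegrand n k₁ k₂ R p (π * I + r * z)) -
      E * (π * I) ^ (n + k₁ + k₂) * (2 * π * I * I ^ q * besselI q κ) =
      E * squareIntegral (fun z ↦ M z * (regularFactor n k₁ k₂ R (r * z) -
        (π * I) ^ (n + k₁ + k₂))) := by
    rw [← squareIntegral_besselI_generating, ← squareIntegral_const_mul,
      ← squareIntegral_sub hFc (hMc.const_mul _), ← squareIntegral_const_mul]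
    refine squareIntegral_congr fun z hz ↦ ?_
    rw [hF hz]
    ring
  have hEn : ‖E‖ = rexp (-(π * p)) * (r ^ (q + 1))⁻¹ := by
    rw [hE, hq]
    simp [-Complex.ofReal_exp, abs_of_pos hr0]
  have hrE : (rexp (-(π * p)) * (-1) ^ n * ((r ^ q)⁻¹ : ℝ) : ℂ) = r * E := by
    rw [hE, hq, pow_succ]
    push_cast
    field_simp
  rw [hrE]
  have hbound := norm_squareIntegral_le (g := fun z ↦ M z * (regularFactor n k₁ k₂ R (r * z) -
        (π * I) ^ (n + k₁ + k₂))) (B := rexp (2 * C) * (K * (2 * π + C) * δ)) fun z hz ↦ by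
    rw [norm_mul]
    have h1 := hrz hz
    have h2 := hreg (r * z) R (by linarith) hR0 (by linarith)
    have h3 : ‖r * z‖ + R ≤ (2 * π + C) * δ := by linarith
    refine mul_le_mul (hMn hz) (h2.trans ?_) (norm_nonneg _) (Real.exp_pos _).le
    rw [mul_assoc]
    gcongr
  have hfac : r * squareIntegral (fun z ↦ heatIntegrand n k₁ k₂ R p (π * I + r * z)) -
      r * E * (π * I) ^ (n + k₁ + k₂) * (2 * π * I * I ^ q * besselI q κ) =
      r * E * squareIntegral (fun z ↦ M z * (regularFactor n k₁ k₂ R (r * z) -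
        (π * I) ^ (n + k₁ + k₂))) := by
    linear_combination r * hmain
  rw [hfac, norm_mul, norm_mul, norm_real, Real.norm_of_nonneg hr0.le, hEn]
  calc _ ≤ r * (rexp (-(π * p)) * (r ^ (q + 1))⁻¹) *
        (8 * (rexp (2 * C) * (K * (2 * π + C) * δ))) := by gcongr
    _ = _ := by
      rw [pow_succ]
      field_simp

lemma prefactor_mul_main_term {n k₁ q : ℕ} (hq : n + k₁ = q + 1) (k₂ : ℕ) (r e b : ℝ) :
    (2 * (-1 : ℂ) ^ k₁ * I ^ k₂ / (4 * (π : ℂ)) ^ (n + 1)) *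
        (e * (-1) ^ n * ((r ^ q)⁻¹ : ℝ) * (π * I) ^ (n + k₁ + k₂) * (2 * π * I * I ^ q * b)) =
      ((-1 : ℝ) ^ k₂ * π ^ (k₁ + k₂) / (4 ^ n * r ^ q) * e * b : ℝ) := by
  have hπ : (π : ℂ) ≠ 0 := by exact_mod_cast Real.pi_ne_zero
  have hI : I ^ k₂ * I ^ (n + k₁ + k₂) * (I * I ^ q) = (-1) ^ n * (-1) ^ k₁ * (-1) ^ k₂ := by
    rw [← pow_succ', ← hq, ← pow_add, ← pow_add, ← pow_add, ← pow_add, ← Complex.I_sq, ← pow_mul]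
    congr 1
    ring
  have hs (m : ℕ) : ((-1 : ℂ) ^ m) * (-1) ^ m = 1 := by
    rw [← mul_pow, neg_one_mul, neg_neg, one_pow]
  have hπ' : (2 * (2 * π) / (4 * (π : ℂ)) ^ (n + 1)) * (π : ℂ) ^ (n + k₁ + k₂) =
      π ^ (k₁ + k₂) / 4 ^ n := by
    rw [mul_pow, pow_succ, pow_succ, add_assoc n, pow_add _ n]
    field_simp
    ring
  calc _ = (2 * (2 * π) / (4 * (π : ℂ)) ^ (n + 1)) * (π : ℂ) ^ (n + k₁ + k₂) *
        (((-1) ^ k₁ * (-1) ^ n) * (I ^ k₂ * I ^ (n + k₁ + k₂) * (I * I ^ q))) *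
        (e * ((r ^ q)⁻¹ : ℝ) * b) := by
        rw [mul_pow (π : ℂ) I]
        ring
    _ = π ^ (k₁ + k₂) / 4 ^ n * (((-1) ^ k₁ * (-1) ^ k₁) * ((-1) ^ n * (-1) ^ n) * (-1) ^ k₂) *
        (e * ((r ^ q)⁻¹ : ℝ) * b) := by
        rw [hπ', hI]
        ring
    _ = _ := by
        rw [hs, hs]
        push_cast
        ring

/-- The oscillatory integral is, up to a relative error `O(δ)`, given by the residue at `π * I`. -/
lemma exists_norm_pH_sub_le {n : ℕ} (hn : 1 ≤ n) (k₁ k₂ q : ℕ) (hq : n + k₁ = q + 1) {C : ℝ}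
    (hC : 0 < C) :
    ∃ ρ > 0, ∃ K > 0, ∀ (x : EuclideanSpace ℝ (Fin (2 * n))) (t δ κ : ℝ),
      0 < δ → δ ≤ ρ → 1 / C ≤ κ → κ ≤ C → ‖x‖ ^ 2 / 4 = κ * δ / 2 → |t| = κ / (2 * π * δ) →
      ‖pH n k₁ k₂ x t - ((-1 : ℝ) ^ k₂ * π ^ (k₁ + k₂) / (4 ^ n * (π * δ) ^ q) *
          rexp (-(π * |t|)) * besselI q κ : ℝ)‖ ≤
        K * δ * (rexp (-(π * |t|)) * ((π * δ) ^ q)⁻¹) := by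
  obtain ⟨ρ, hρ, K, hK, h⟩ := exists_norm_squareIntegral_sub_le n k₁ k₂ q hq hC
  have hπ := Real.pi_pos
  have hπ4 := Real.pi_lt_d2
  have hπ3 := Real.pi_gt_three
  set c : ℂ := 2 * (-1 : ℂ) ^ k₁ * I ^ k₂ / (4 * (π : ℂ)) ^ (n + 1) with hc
  set T : ℝ := 2 ^ (n + k₁) * (2 * (n + k₁ + k₂ + 2).factorial * rexp 5) with hT
  have hT0 : 0 < T := by positivity
  refine ⟨min ρ (1 / 10), by positivity, ‖c‖ * (K + 4 * C * (T * π)) + 1, by positivity,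
    fun x t δ κ hδ hδρ hκ hκC hR hp ↦ ?_⟩
  have hκ0 : 0 < κ := lt_of_lt_of_le (by positivity) hκ
  have hr0 : 0 < π * δ := by positivity
  have hr1 : π * δ < 1 := by
    have := hδρ.trans (min_le_right _ _)
    nlinarith
  have hE := h δ κ hδ (hδρ.trans (min_le_left _ _)) hκ0.le hκC
  have hshift := norm_integral_heatIntegrand_shift_le hn k₁ k₂ (R := κ * δ / 2) (p := |t|)
    (by positivity)
  rw [← hp] at hE
  have hhalf : rexp (-(π * |t|) / 2) ≤ 4 * C * δ := by
    have h1 : π * |t| / 2 = κ / (4 * δ) := by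
      rw [hp]
      field_simp
      ring
    rw [neg_div, h1, Real.exp_neg]
    have h2 : 0 < κ / (4 * δ) := by positivity
    have h3 := Real.add_one_le_exp (κ / (4 * δ))
    calc _ ≤ (κ / (4 * δ))⁻¹ := by gcongr; linarith
      _ = 4 * δ * (1 / κ) := by rw [inv_div]; ring
      _ ≤ 4 * δ * C := by
        gcongr
        rw [div_le_iff₀ hκ0]
        rwa [div_le_iff₀ hC, mul_comm] at hκ
      _ = _ := by ring
  have hrem : rexp (-|t| * (3 * π / 2)) * T * π ≤
      4 * C * (T * π) * δ * (rexp (-(π * |t|)) * ((π * δ) ^ q)⁻¹) := by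
    have h1 : rexp (-|t| * (3 * π / 2)) = rexp (-(π * |t|)) * rexp (-(π * |t|) / 2) := by
      rw [← Real.exp_add]
      congr 1
      ring
    have h2 : 1 ≤ ((π * δ) ^ q)⁻¹ :=
      (one_le_inv₀ (by positivity)).2 (pow_le_one₀ hr0.le hr1.le)
    calc _ = rexp (-(π * |t|)) * rexp (-(π * |t|) / 2) * 1 * (T * π) := by rw [h1]; ring
      _ ≤ rexp (-(π * |t|)) * (4 * C * δ) * ((π * δ) ^ q)⁻¹ * (T * π) := by gcongr
      _ = _ := by ring
  rw [pH_eq, hR, integral_heatIntegrand_eq hn k₁ k₂ (by positivity) (abs_nonneg t) hr0 hr1,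
    ← prefactor_mul_main_term hq, ← hc, ← mul_sub, norm_mul, add_sub_right_comm]
  set D := rexp (-(π * |t|)) * ((π * δ) ^ q)⁻¹ with hD
  have hD0 : 0 < D := by positivity
  calc _ ≤ ‖c‖ * (K * δ * D + 4 * C * (T * π) * δ * D) := by
        gcongr
        exact (norm_add_le _ _).trans (add_le_add hE (hshift.trans hrem))
    _ = ‖c‖ * (K + 4 * C * (T * π)) * δ * D := by ring
    _ ≤ _ := by
        gcongr
        linarith

lemma pi_sub_one_lt_of_ten_lt_theta {y : ℝ} (hy : 0 ≤ y) (h : 10 < theta y) : π - 1 < y := by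
  by_contra! hc
  exact h.not_ge (theta_le_ten hy hc)

/-- Case III asymptotics on the Heisenberg group: for δ → 0⁺ and 1/C ≤ κ ≤ C,
p_{1,k₁,k₂}(x,t) = ((−1)^{k₂}π^{k₁+k₂}/(4ⁿ(πδ)^{n+k₁−1})) e^{−d²/4} e^{−κ} I_{n+k₁−1}(κ)[1 + O(δ)]. -/
theorem heisenberg_caseIII (n k₁ k₂ : ℕ) (hn : 1 ≤ n) (C : ℝ) (hC : 1 < C) :
    ∃ K : ℝ, 0 < K ∧ ∃ δ₀ : ℝ, 0 < δ₀ ∧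
      ∀ (x : EuclideanSpace ℝ (Fin (2 * n))) (t : ℝ) (yω δ κ d P : ℝ),
        x ≠ 0 → t ≠ 0 →
        yω ∈ Set.Ico 0 π → theta yω = 4 * |t| / ‖x‖ ^ 2 →
        δ = Real.sqrt ((‖x‖ ^ 2 / 4) / (π * |t|)) →
        κ = 2 * Real.sqrt (π * |t| * (‖x‖ ^ 2 / 4)) →
        d = ‖x‖ * yω / Real.sin yω →
        P = ((-1 : ℝ) ^ k₂ * π ^ (k₁ + k₂) / (4 ^ n * (π * δ) ^ (n + k₁ - 1))) *
            Real.exp (-d ^ 2 / 4) * Real.exp (-κ) * besselI ((n : ℤ) + k₁ - 1) κ →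
        δ ≤ δ₀ → 1 / C ≤ κ → κ ≤ C →
        ‖pH n k₁ k₂ x t - (P : ℂ)‖ ≤ K * δ * |P| := by
  obtain ⟨q, hq⟩ : ∃ q, n + k₁ = q + 1 := ⟨n + k₁ - 1, by omega⟩
  have hC0 : 0 < C := by linarith
  have hπ := Real.pi_pos
  have hπ4 := Real.pi_lt_d2
  obtain ⟨ρ, hρ, K, hK, hmain⟩ := exists_norm_pH_sub_le hn k₁ k₂ q hq hC0
  set a : ℝ := π ^ (k₁ + k₂) / 4 ^ n * ((1 / C / 2) ^ q / q.factorial) with ha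
  have ha0 : 0 < a := by positivity
  refine ⟨3 * (K / a) + 20 * C, by positivity, min ρ (min (1 / 10) (1 / (10 * C))), by positivity,
    fun x t yω δ κ d P hx ht hy hθ hδ hκ hd hP hδ₀ hκ1 hκC ↦ ?_⟩
  have hx0 : 0 < ‖x‖ := norm_pos_iff.2 hx
  have ht0 : 0 < |t| := abs_pos.2 ht
  have hδ0 : 0 < δ := by
    rw [hδ]
    positivity
  have hκ0 : 0 < κ := lt_of_lt_of_le (by positivity) hκ1
  have hδρ : δ ≤ ρ := hδ₀.trans (min_le_left _ _)
  have hδ1 : δ ≤ 1 / 10 := hδ₀.trans ((min_le_right _ _).trans (min_le_left _ _))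
  have hδC : δ * (10 * C) ≤ 1 :=
    (le_div_iff₀ (by positivity)).1 (hδ₀.trans ((min_le_right _ _).trans (min_le_right _ _)))
  have hδsq : δ ^ 2 * (π * |t|) = ‖x‖ ^ 2 / 4 := by
    rw [hδ, Real.sq_sqrt (by positivity)]
    field_simp
  have hκδ : κ = 2 * π * δ * |t| := by
    have h : √(π * |t| * (‖x‖ ^ 2 / 4)) = π * |t| * δ := by
      rw [← hδsq, show π * |t| * (δ ^ 2 * (π * |t|)) = (π * |t| * δ) ^ 2 by ring,
        Real.sqrt_sq (by positivity)]
    rw [hκ, h]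
    ring
  have hR : ‖x‖ ^ 2 / 4 = κ * δ / 2 := by
    rw [← hδsq, hκδ]
    ring
  have hp : |t| = κ / (2 * π * δ) := by
    rw [hκδ]
    field_simp
  have hθ' : theta yω = |t| / (‖x‖ ^ 2 / 4) := by
    rw [hθ]
    field_simp
  have hθ10 : 10 < theta yω := by
    rw [hθ', lt_div_iff₀ (by positivity), ← hδsq]
    have h1 : δ ^ 2 ≤ 1 / 100 := by nlinarith
    have h2 : 10 * (δ ^ 2 * π) < 1 := by nlinarith
    calc _ = 10 * (δ ^ 2 * π) * |t| := by ring
      _ < 1 * |t| := by gcongr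
      _ = _ := one_mul _
  have hphase := abs_phase_sub_le (pi_sub_one_lt_of_ten_lt_theta hy.1 hθ10) hy.2 (by positivity)
    ht0 hθ'
  rw [← hκ] at hphase
  set E : ℝ := ‖x‖ ^ 2 / 4 * (yω / Real.sin yω) ^ 2 + κ - π * |t| with hE
  have hEδ : |E| ≤ 10 * C * δ := by
    refine hphase.trans ?_
    rw [hR]
    nlinarith
  have hE1 : |E| ≤ 1 := hEδ.trans (by linarith)
  have hexp := Real.abs_exp_sub_one_le hE1
  set P' : ℝ := (-1 : ℝ) ^ k₂ * π ^ (k₁ + k₂) / (4 ^ n * (π * δ) ^ q) *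
    rexp (-(π * |t|)) * besselI q κ with hP'
  have hPP' : P' = P * rexp E := by
    have h1 : (n : ℤ) + k₁ - 1 = q := by omega
    have h2 : n + k₁ - 1 = q := by omega
    have h3 : rexp (-(π * |t|)) = rexp (-d ^ 2 / 4) * rexp (-κ) * rexp E := by
      rw [← Real.exp_add, ← Real.exp_add, hd, hE]
      congr 1
      ring
    rw [hP, hP', h1, h2, h3]
    ring
  have hsub : |P' - P| ≤ 20 * C * δ * |P| := by
    rw [hPP', ← mul_sub_one, abs_mul, mul_comm]
    gcongr
    linarith
  have hP'le : |P'| ≤ 3 * |P| := by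
    have h1 := abs_sub_abs_le_abs_sub P' P
    have h2 : 20 * C * δ * |P| ≤ 2 * |P| := by
      gcongr
      linarith
    linarith
  have hlow : rexp (-(π * |t|)) * ((π * δ) ^ q)⁻¹ ≤ |P'| / a := by
    have hI := div_factorial_le_besselI q hκ0.le
    have hI' : (1 / C / 2) ^ q / q.factorial ≤ besselI q κ := le_trans (by gcongr) hI
    have hI0 : 0 ≤ besselI q κ := le_trans (by positivity) hI'
    rw [le_div_iff₀ ha0]
    have habs : |P'| = rexp (-(π * |t|)) * ((π * δ) ^ q)⁻¹ *
        (π ^ (k₁ + k₂) / 4 ^ n * besselI q κ) := by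
      rw [hP', abs_mul, abs_mul, abs_div, abs_mul, abs_pow, abs_neg, abs_one, one_pow, one_mul,
        abs_of_nonneg hI0, abs_of_pos (Real.exp_pos _), abs_of_pos (by positivity),
        abs_of_pos (by positivity)]
      field_simp
    rw [habs, ha]
    gcongr
  calc ‖pH n k₁ k₂ x t - (P : ℂ)‖ ≤ ‖pH n k₁ k₂ x t - (P' : ℂ)‖ + ‖(P' : ℂ) - (P : ℂ)‖ :=
        norm_sub_le_norm_sub_add_norm_sub _ _ _
    _ ≤ K * δ * (|P'| / a) + 20 * C * δ * |P| := by
        refine add_le_add ((hmain x t δ κ hδ0 hδρ hκ1 hκC hR hp).trans (by gcongr)) ?_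
        rwa [← Complex.ofReal_sub, norm_real, Real.norm_eq_abs]
    _ ≤ K * δ * (3 * |P| / a) + 20 * C * δ * |P| := by gcongr
    _ = (3 * (K / a) + 20 * C) * δ * |P| := by ring
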